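/- There exist universal constants N₀ ≥ 2 and c₀ ≥ 1 such that the following holds. Let r ≥ 1 be an integer and let G be a graph on n vertices with n^{1/r} ≥ N₀ whose maximum vertex degree is at most c₀·log₂ n. Then either (i) there is a partition (A,B) of V(G) with |A| ≥ n/4, |B| ≥ n/4 and |E_G(A,B)| ≤ n/100, or (ii) there is a subset S ⊆ V(G) with |S| ≥ n/2 such that the induced subgraph G[S] is a (log₂ n)^{−c₀·r}-expander. -/

import Mathlib

open Finset
open scoped Classical

variable {V : Type*}

/-- The number of edges of `G` with one endpoint in `A` and the other in `B`
(for disjoint `A`, `B`). -/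
noncomputable def interEdges (G : SimpleGraph V) (A B : Finset V) : ℕ :=
  ((A ×ˢ B).filter fun p => G.Adj p.1 p.2).card

/-- The degree of a vertex. -/
noncomputable def deg [Fintype V] (G : SimpleGraph V) (v : V) : ℕ :=
  (Finset.univ.filter fun u => G.Adj v u).card

/-- The induced subgraph `G[U]` is a `ψ`-expander: every cut of `G[U]` has
sparsity at least `ψ` (vacuously true if there are no cuts, matching the
convention `min ∅ = +∞`). -/
def expanderGe (G : SimpleGraph V) (U : Finset V) (ψ : ℝ) : Prop :=
  ∀ S ⊆ U, S.Nonempty → (U \ S).Nonempty →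
    ψ * ((min S.card (U \ S).card : ℕ) : ℝ) ≤ (interEdges G S (U \ S) : ℝ)

lemma interEdges_comm (G : SimpleGraph V) (A B : Finset V) :
    interEdges G A B = interEdges G B A := by
  unfold interEdges
  refine Finset.card_bij' (fun p _ => p.swap) (fun p _ => p.swap) ?_ ?_ ?_ ?_
  · intro p hp
    simp only [mem_filter, mem_product, Prod.fst_swap, Prod.snd_swap] at hp ⊢
    exact ⟨hp.1.symm, hp.2.symm⟩
  · intro p hp
    simp only [mem_filter, mem_product, Prod.fst_swap, Prod.snd_swap] at hp ⊢
    exact ⟨hp.1.symm, hp.2.symm⟩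
  · simp
  · simp

lemma interEdges_mono (G : SimpleGraph V) {A A' B B' : Finset V} (hA : A ⊆ A') (hB : B ⊆ B') :
    interEdges G A B ≤ interEdges G A' B' :=
  card_le_card (filter_subset_filter _ (product_subset_product hA hB))

lemma interEdges_union_left_le (G : SimpleGraph V) (A A' B : Finset V) :
    interEdges G (A ∪ A') B ≤ interEdges G A B + interEdges G A' B := by
  unfold interEdges
  rw [union_product, filter_union]
  exact card_union_le _ _

/-- If `G[U]` is not a `ψ`-expander, this is witnessed by the smaller side of a cut. -/
lemma exists_sparse_cut_of_not_expanderGe (G : SimpleGraph V) {U : Finset V} {ψ : ℝ}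
    (h : ¬ expanderGe G U ψ) :
    ∃ S ⊆ U, S.Nonempty ∧ S.card ≤ (U \ S).card ∧
      (interEdges G S (U \ S) : ℝ) < ψ * S.card := by
  unfold expanderGe at h
  push Not at h
  obtain ⟨S, hSU, hS, hS', hlt⟩ := h
  rcases le_total S.card (U \ S).card with hle | hle
  · rw [min_eq_left hle] at hlt
    exact ⟨S, hSU, hS, hle, hlt⟩
  · rw [min_eq_right hle, interEdges_comm] at hlt
    refine ⟨U \ S, sdiff_subset, hS', ?_⟩
    rw [Finset.sdiff_sdiff_eq_self hSU]
    exact ⟨hle, hlt⟩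

/-- For `0 ≤ ψ`, a finite graph has either a balanced cut with at most `ψ n` edges or a
`ψ`-expander induced on at least half of the vertices. -/
lemma exists_balanced_cut_or_expanderGe [Fintype V] (G : SimpleGraph V) {ψ : ℝ} (hψ : 0 ≤ ψ) :
    (∃ A : Finset V, (Fintype.card V : ℝ) / 4 ≤ A.card ∧ (Fintype.card V : ℝ) / 4 ≤ Aᶜ.card ∧
      (interEdges G A Aᶜ : ℝ) ≤ ψ * Fintype.card V) ∨
    ∃ S : Finset V, (Fintype.card V : ℝ) / 2 ≤ S.card ∧ expanderGe G S ψ := by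
  let F : Finset (Finset V) := univ.filter fun R =>
    (R.card : ℝ) ≤ (Fintype.card V : ℝ) / 4 ∧ (interEdges G R Rᶜ : ℝ) ≤ ψ * R.card
  have hF : F.Nonempty := ⟨∅, by
    simp only [F, mem_filter, mem_univ, true_and]
    constructor
    · rw [card_empty, Nat.cast_zero]
      positivity
    · simp [interEdges]⟩
  obtain ⟨R, hR, hmax⟩ := exists_max_image F Finset.card hF
  simp only [F, mem_filter, mem_univ, true_and] at hR hmax
  obtain ⟨hRcard, hRe⟩ := hR
  have hRc : (R.card : ℝ) + Rᶜ.card = Fintype.card V := by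
    exact_mod_cast card_add_card_compl R
  by_cases hexp : expanderGe G Rᶜ ψ
  · exact Or.inr ⟨Rᶜ, by linarith [(Nat.cast_nonneg R.card : (0 : ℝ) ≤ R.card)], hexp⟩
  left
  obtain ⟨S, hSU, hS, hle, hlt⟩ := exists_sparse_cut_of_not_expanderGe G hexp
  have hcompl : (R ∪ S)ᶜ = Rᶜ \ S := by
    ext x
    simp
  have hdisj : Disjoint R S := (disjoint_compl_right (a := R)).mono_right hSU
  have hcard : (R ∪ S).card = R.card + S.card := card_union_of_disjoint hdisj
  have hcardR : ((R ∪ S).card : ℝ) = R.card + S.card := by exact_mod_cast hcard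
  have hedges : (interEdges G (R ∪ S) (R ∪ S)ᶜ : ℝ) ≤ ψ * (R ∪ S).card := by
    have h₁ : (interEdges G (R ∪ S) (R ∪ S)ᶜ : ℝ)
        ≤ interEdges G R Rᶜ + interEdges G S (Rᶜ \ S) := by
      rw [hcompl]
      exact_mod_cast (interEdges_union_left_le G R S _).trans
        (Nat.add_le_add_right (interEdges_mono G Subset.rfl sdiff_subset) _)
    rw [hcardR]
    linarith
  have hbig : (Fintype.card V : ℝ) / 4 < (R ∪ S).card := by
    by_contra! hcon
    have := hmax (R ∪ S) ⟨hcon, hedges⟩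
    have := hS.card_pos
    omega
  have hsplit : (S.card : ℝ) + (Rᶜ \ S).card = Rᶜ.card := by
    rw [add_comm]
    exact_mod_cast card_sdiff_add_card_eq_card hSU
  have hleR : (S.card : ℝ) ≤ (Rᶜ \ S).card := by exact_mod_cast hle
  refine ⟨R ∪ S, hbig.le, ?_, hedges.trans ?_⟩
  · rw [hcompl]
    linarith [(Nat.cast_nonneg (Fintype.card V) : (0 : ℝ) ≤ Fintype.card V)]
  · exact mul_le_mul_of_nonneg_left (by exact_mod_cast card_le_univ _) hψ

/-- the combinatorial content of the `CutOrCertify` theorem. -/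
theorem cutOrCertify_exists :
    ∃ N₀ c₀ : ℕ, 2 ≤ N₀ ∧ 1 ≤ c₀ ∧
      ∀ (V : Type) [Fintype V] [DecidableEq V] (G : SimpleGraph V) (r : ℕ),
        1 ≤ r →
        (N₀ : ℝ) ≤ (Fintype.card V : ℝ) ^ ((1 : ℝ) / (r : ℝ)) →
        (∀ v : V, (deg G v : ℝ) ≤ (c₀ : ℝ) * Real.logb 2 (Fintype.card V)) →
        (∃ A B : Finset V, Disjoint A B ∧ A ∪ B = Finset.univ ∧
            (Fintype.card V : ℝ) / 4 ≤ (A.card : ℝ) ∧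
            (Fintype.card V : ℝ) / 4 ≤ (B.card : ℝ) ∧
            (interEdges G A B : ℝ) ≤ (Fintype.card V : ℝ) / 100) ∨
          (∃ S : Finset V, (Fintype.card V : ℝ) / 2 ≤ (S.card : ℝ) ∧
            expanderGe G S (1 / Real.logb 2 (Fintype.card V) ^ (c₀ * r))) := by
  refine ⟨2 ^ 100, 1, by norm_num, le_rfl, ?_⟩
  intro V _ _ G r hr hN _
  have hrR : (1 : ℝ) ≤ r := by exact_mod_cast hr
  have hn : (1 : ℝ) ≤ Fintype.card V := by
    rcases Nat.eq_zero_or_pos (Fintype.card V) with h0 | h0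
    · rw [h0, Nat.cast_zero, Real.zero_rpow (by positivity)] at hN
      norm_num at hN
    · exact_mod_cast h0
  have hnN : (2 : ℝ) ^ (100 : ℝ) ≤ Fintype.card V := by
    have h₁ : (Fintype.card V : ℝ) ^ ((1 : ℝ) / (r : ℝ)) ≤ Fintype.card V :=
      Real.rpow_le_self_of_one_le hn (by rw [div_le_one (by linarith)]; exact hrR)
    have h₂ := hN.trans h₁
    push_cast at h₂
    exact_mod_cast h₂
  have hlog : 100 ≤ Real.logb 2 (Fintype.card V) :=
    (Real.le_logb_iff_rpow_le (by norm_num) (by linarith)).2 hnN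
  have hpow : 100 ≤ Real.logb 2 (Fintype.card V) ^ (1 * r) :=
    hlog.trans (le_self_pow₀ (by linarith) (by omega))
  have hψ : 1 / Real.logb 2 (Fintype.card V) ^ (1 * r) ≤ 1 / 100 :=
    one_div_le_one_div_of_le (by norm_num) hpow
  rcases exists_balanced_cut_or_expanderGe G
    (ψ := 1 / Real.logb 2 (Fintype.card V) ^ (1 * r)) (by positivity) with
    ⟨A, hA, hAc, hE⟩ | hS
  · refine Or.inl ⟨A, _, ?_, ?_, hA, hAc, hE.trans ?_⟩
    · simp [Finset.disjoint_left]
    · ext x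
      simp [Classical.em]
    · have := mul_le_mul_of_nonneg_right hψ (zero_le_one.trans hn)
      linarith
  · exact Or.inr hS
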